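/- arXiv:2501.12378 — 7 statements merged into one kernel-verified Lean document; each statement's English description precedes it below -/
import Mathlib

section
/- Let A, B, C be finite-dimensional complex inner product spaces and d₀ : A → B, d₁ : B → C linear maps with d₁ ∘ d₀ = 0, and let Δ = d₁† ∘ d₁ + d₀ ∘ d₀†. Then the three subspaces ker Δ, range d₀, and range d₁† of B are pairwise orthogonal and their sum is all of B, i.e. B decomposes as the orthogonal internal direct sum B = ker Δ ⊕ range d₀ ⊕ range d₁† (Hodge decomposition). -/
/-- The harmonic elements are those annihilated by both `d₁` and the adjoint of `d₀`. -/
theorem ker_adjoint_comp_self_add_comp_adjoint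
    {𝕜 A B C : Type*} [RCLike 𝕜]
    [NormedAddCommGroup A] [InnerProductSpace 𝕜 A] [FiniteDimensional 𝕜 A]
    [NormedAddCommGroup B] [InnerProductSpace 𝕜 B] [FiniteDimensional 𝕜 B]
    [NormedAddCommGroup C] [InnerProductSpace 𝕜 C] [FiniteDimensional 𝕜 C]
    (d₀ : A →ₗ[𝕜] B) (d₁ : B →ₗ[𝕜] C) :
    LinearMap.ker (LinearMap.adjoint d₁ ∘ₗ d₁ + d₀ ∘ₗ LinearMap.adjoint d₀) =
      LinearMap.ker d₁ ⊓ LinearMap.ker (LinearMap.adjoint d₀) := by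
  ext x
  simp only [Submodule.mem_inf, LinearMap.mem_ker, LinearMap.add_apply, LinearMap.comp_apply]
  refine ⟨fun hx => ?_, fun ⟨h₁, h₀⟩ => by simp [h₁, h₀]⟩
  have key : ‖d₁ x‖ ^ 2 + ‖LinearMap.adjoint d₀ x‖ ^ 2 = 0 := by
    have := congrArg (fun y => RCLike.re (inner 𝕜 x y)) hx
    beta_reduce at this
    rwa [inner_add_right, LinearMap.adjoint_inner_right, ← LinearMap.adjoint_inner_left d₀,
      map_add, inner_self_eq_norm_sq, inner_self_eq_norm_sq, inner_zero_right, map_zero] at this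
  constructor <;> rw [← norm_eq_zero, ← sq_eq_zero_iff] <;> nlinarith [sq_nonneg ‖d₁ x‖,
    sq_nonneg ‖LinearMap.adjoint d₀ x‖]


/-- Hodge decomposition: for a two-step complex `d₀ : A → B`, `d₁ : B → C` of
finite-dimensional complex inner product spaces with `d₁ ∘ d₀ = 0` and Hodge Laplacian
`Δ = d₁† ∘ d₁ + d₀ ∘ d₀†` on `B`, the subspaces `ker Δ`, `range d₀`, `range d₁†` are
pairwise orthogonal and together span `B`. -/
theorem hodge_decomposition
    {A B C : Type*}
    [NormedAddCommGroup A] [InnerProductSpace ℂ A] [FiniteDimensional ℂ A]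
    [NormedAddCommGroup B] [InnerProductSpace ℂ B] [FiniteDimensional ℂ B]
    [NormedAddCommGroup C] [InnerProductSpace ℂ C] [FiniteDimensional ℂ C]
    (d₀ : A →ₗ[ℂ] B) (d₁ : B →ₗ[ℂ] C) (h : d₁ ∘ₗ d₀ = 0) :
    Submodule.IsOrtho
        (LinearMap.ker (LinearMap.adjoint d₁ ∘ₗ d₁ + d₀ ∘ₗ LinearMap.adjoint d₀))
        (LinearMap.range d₀) ∧
    Submodule.IsOrtho
        (LinearMap.ker (LinearMap.adjoint d₁ ∘ₗ d₁ + d₀ ∘ₗ LinearMap.adjoint d₀))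
        (LinearMap.range (LinearMap.adjoint d₁)) ∧
    Submodule.IsOrtho (LinearMap.range d₀) (LinearMap.range (LinearMap.adjoint d₁)) ∧
    LinearMap.ker (LinearMap.adjoint d₁ ∘ₗ d₁ + d₀ ∘ₗ LinearMap.adjoint d₀) ⊔
        LinearMap.range d₀ ⊔ LinearMap.range (LinearMap.adjoint d₁) = ⊤ := by
  have hker : LinearMap.ker (LinearMap.adjoint d₁ ∘ₗ d₁ + d₀ ∘ₗ LinearMap.adjoint d₀) =
      (LinearMap.range d₀ ⊔ LinearMap.range (LinearMap.adjoint d₁))ᗮ := by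
    rw [ker_adjoint_comp_self_add_comp_adjoint, ← Submodule.inf_orthogonal,
      LinearMap.orthogonal_range, LinearMap.orthogonal_range, LinearMap.adjoint_adjoint,
      inf_comm]
  rw [hker]
  refine ⟨Submodule.orthogonal_le le_sup_left, Submodule.orthogonal_le le_sup_right, ?_, ?_⟩
  · rw [Submodule.isOrtho_iff_le, LinearMap.orthogonal_range, LinearMap.adjoint_adjoint]
    exact LinearMap.range_le_ker_iff.mpr h
  · rw [sup_assoc, sup_comm]
    exact Submodule.sup_orthogonal_of_hasOrthogonalProjection
end

section
/- Let A, B, C be finite-dimensional complex inner product spaces and d₀ : A → B, d₁ : B → C linear maps with d₁ ∘ d₀ = 0, and let Δ = d₁† ∘ d₁ + d₀ ∘ d₀†. If λ is an eigenvalue of Δ (i.e. Δv = λv for some v ≠ 0 in B), then λ is an eigenvalue of d₁† ∘ d₁ or an eigenvalue of d₀ ∘ d₀†, viewed as operators on B. -/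
/-- If `P * Q = 0`, every eigenvalue of `P + Q` is an eigenvalue of `P` or of `Q`. -/
theorem Module.End.HasEigenvalue.of_add_of_mul_eq_zero {R M : Type*} [CommRing R]
    [AddCommGroup M] [Module R M] {P Q : Module.End R M} (hPQ : P * Q = 0) {μ : R}
    (hμ : (P + Q).HasEigenvalue μ) : P.HasEigenvalue μ ∨ Q.HasEigenvalue μ := by
  obtain ⟨v, hv⟩ := hμ.exists_hasEigenvector
  have hsum : P v + Q v = μ • v := hv.apply_eq_smul
  by_cases hPv : P v = 0
  · rw [hPv, zero_add] at hsum
    exact .inr (Module.End.hasEigenvalue_of_hasEigenvector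
      ⟨Module.End.mem_eigenspace_iff.mpr hsum, hv.2⟩)
  · have hPQv : P (Q v) = 0 := LinearMap.congr_fun hPQ v
    have hPPv : P (P v) = μ • P v := by
      simpa only [map_add, map_smul, hPQv, add_zero] using congrArg P hsum
    exact .inl (Module.End.hasEigenvalue_of_hasEigenvector
      ⟨Module.End.mem_eigenspace_iff.mpr hPPv, hPv⟩)

/-- For a two-step complex `d₀ : A → B`, `d₁ : B → C` of finite-dimensional complex inner
product spaces with `d₁ ∘ d₀ = 0`, every eigenvalue of the Hodge Laplacian
`Δ = d₁† ∘ d₁ + d₀ ∘ d₀†` is an eigenvalue of `d₁† ∘ d₁` or of `d₀ ∘ d₀†`. -/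
theorem hodge_eigenvalue_of_parts
    {A B C : Type*}
    [NormedAddCommGroup A] [InnerProductSpace ℂ A] [FiniteDimensional ℂ A]
    [NormedAddCommGroup B] [InnerProductSpace ℂ B] [FiniteDimensional ℂ B]
    [NormedAddCommGroup C] [InnerProductSpace ℂ C] [FiniteDimensional ℂ C]
    (d₀ : A →ₗ[ℂ] B) (d₁ : B →ₗ[ℂ] C) (h : d₁ ∘ₗ d₀ = 0) (lam : ℂ)
    (hlam : Module.End.HasEigenvalue
      (LinearMap.adjoint d₁ ∘ₗ d₁ + d₀ ∘ₗ LinearMap.adjoint d₀) lam) :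
    Module.End.HasEigenvalue (LinearMap.adjoint d₁ ∘ₗ d₁) lam ∨
      Module.End.HasEigenvalue (d₀ ∘ₗ LinearMap.adjoint d₀) lam := by
  refine Module.End.HasEigenvalue.of_add_of_mul_eq_zero ?_ hlam
  rw [Module.End.mul_eq_comp, LinearMap.comp_assoc, ← LinearMap.comp_assoc _ d₀ d₁, h,
    LinearMap.zero_comp, LinearMap.comp_zero]
end

section
/- For every n ≥ 1 and all 1 ≤ a < b ≤ n+1, the operator Δ = Σ_{i=1}^n A_i on W_n satisfies Δ e_{s_{a,b}} = (4 − δ_{a,1} − δ_{b,n+1} − δ_{b,a+1}) e_{s_{a,b}} + e_{s_{a−1,b}} + e_{s_{a+1,b}} + e_{s_{a,b−1}} + e_{s_{a,b+1}}, where δ is the Kronecker delta. In particular the span of the vectors e_{s_{a,b}} (1 ≤ a < b ≤ n+1), which has dimension C(n+1, 2), is invariant under Δ. -/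
noncomputable section

/-- The complex vector space `W_n` with (orthonormal) basis indexed by strings
`s : Fin (n+1) → Bool`, where `true` represents the label `𝟙` and `false` the label `X`. -/
abbrev TwistSpace (n : ℕ) := (Fin (n + 1) → Bool) → ℂ

/-- The basis vector `e_s` of `W_n`. -/
def eVec (n : ℕ) (s : Fin (n + 1) → Bool) : TwistSpace n := Pi.single s 1

/-- The string `s` with the entries at positions `i` and `i+1` swapped. -/
def swapPos (n : ℕ) (i : Fin n) (s : Fin (n + 1) → Bool) : Fin (n + 1) → Bool :=
  Function.update (Function.update s i.castSucc (s i.succ)) i.succ (s i.castSucc)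

/-- The operator `A_i` on `W_n`: on a basis vector `e_s` it gives `e_s` if
`s(i) = s(i+1) = 𝟙`, gives `e_s + e_{s'}` (with `s'` the swap of `s` at `i, i+1`) if
`s(i) ≠ s(i+1)`, and gives `0` if `s(i) = s(i+1) = X`. -/
def Aop (n : ℕ) (i : Fin n) : TwistSpace n →ₗ[ℂ] TwistSpace n :=
  (Pi.basisFun ℂ (Fin (n + 1) → Bool)).constr ℂ fun s =>
    if s i.castSucc = s i.succ then
      (if s i.castSucc = true then eVec n s else 0)
    else eVec n s + eVec n (swapPos n i s)

/-- The homological-degree-zero Khovanov Hodge Laplacian `Δ = Σ_{i=1}^n A_i` of the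
`n`-fold twisted unknot `TU_n`. -/
def twistLaplacian (n : ℕ) : TwistSpace n →ₗ[ℂ] TwistSpace n := ∑ i : Fin n, Aop n i

/-- The string `s_{a,b}` (for 1-indexed positions `a < b`) which is `𝟙` exactly at
positions `a` and `b` and `X` elsewhere. -/
def sab (n a b : ℕ) : Fin (n + 1) → Bool := fun j => decide (j.val + 1 = a ∨ j.val + 1 = b)

/-- `e_{s_{a,b}}`, with the convention that it is `0` unless `1 ≤ a < b ≤ n+1`. -/
def Eab (n a b : ℕ) : TwistSpace n :=
  if 1 ≤ a ∧ a < b ∧ b ≤ n + 1 then eVec n (sab n a b) else 0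

lemma Aop_eVec (n : ℕ) (i : Fin n) (s : Fin (n + 1) → Bool) :
    Aop n i (eVec n s) =
      if s i.castSucc = s i.succ then
        (if s i.castSucc = true then eVec n s else 0)
      else eVec n s + eVec n (swapPos n i s) := by
  have h : eVec n s = Pi.basisFun ℂ (Fin (n + 1) → Bool) s := by simp [eVec]
  conv_lhs => rw [h]
  rw [Aop, Module.Basis.constr_basis]

lemma swapPos_sab_eq {n a b c d : ℕ} {i : Fin n}
    (h : ∀ j : ℕ, (if j = i.val + 1 then i.val + 1 = a ∨ i.val + 1 = b
        else if j = i.val then i.val + 2 = a ∨ i.val + 2 = b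
        else j + 1 = a ∨ j + 1 = b) ↔ (j + 1 = c ∨ j + 1 = d)) :
    swapPos n i (sab n a b) = sab n c d := by
  funext j
  have hj := h j.val
  simp only [swapPos, Function.update_apply, sab, Fin.ext_iff, Fin.val_succ, Fin.val_castSucc]
  split_ifs at hj ⊢ <;> exact decide_eq_decide.mpr hj

/-- The action of one summand of the Laplacian, as a sum of contributions of the two marked
positions and a correction for adjacent marks. -/
lemma Aop_Eab {n a b : ℕ} (ha : 1 ≤ a) (hab : a < b) (hb : b ≤ n + 1) (i : Fin n) :
    Aop n i (Eab n a b) =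
      (if i.val + 2 = a then Eab n a b + Eab n (a - 1) b else 0)
        + (if i.val + 1 = a then Eab n a b + Eab n (a + 1) b else 0)
        + (if i.val + 2 = b then Eab n a b + Eab n a (b - 1) else 0)
        + (if i.val + 1 = b then Eab n a b + Eab n a (b + 1) else 0)
        - (if i.val + 1 = a then (if b = a + 1 then Eab n a b else 0) else 0) := by
  have hi := i.isLt
  have hE : Eab n a b = eVec n (sab n a b) := if_pos ⟨ha, hab, hb⟩
  have hl : sab n a b i.castSucc = decide (i.val + 1 = a ∨ i.val + 1 = b) := rfl
  have hr : sab n a b i.succ = decide (i.val + 2 = a ∨ i.val + 2 = b) := rfl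
  rw [hE, Aop_eVec, hl, hr]
  by_cases h1 : i.val + 2 = a
  · have e : swapPos n i (sab n a b) = sab n (a - 1) b := swapPos_sab_eq (by grind)
    have e' : Eab n (a - 1) b = eVec n (sab n (a - 1) b) := if_pos (by omega)
    have h2 : i.val + 1 ≠ a := by omega
    have h3 : i.val + 2 ≠ b := by omega
    have h4 : i.val + 1 ≠ b := by omega
    simp [h1, h2, h4, e, e', hab.ne]
  by_cases h4 : i.val + 1 = b
  · have e : swapPos n i (sab n a b) = sab n a (b + 1) := swapPos_sab_eq (by grind)
    have e' : Eab n a (b + 1) = eVec n (sab n a (b + 1)) := if_pos (by omega)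
    have h2 : i.val + 1 ≠ a := by omega
    have h3 : i.val + 2 ≠ b := by omega
    simp [h1, h3, h4, e, e', hab.ne']
  by_cases h2 : i.val + 1 = a
  · by_cases h3 : i.val + 2 = b
    · have h5 : b = a + 1 := by omega
      subst h5
      have e1 : Eab n (a + 1) (a + 1) = 0 := if_neg (by omega)
      have e2 : Eab n a a = 0 := if_neg (by omega)
      simp [h2, h3, e1, e2]
    · have e : swapPos n i (sab n a b) = sab n (a + 1) b := swapPos_sab_eq (by grind)
      have e' : Eab n (a + 1) b = eVec n (sab n (a + 1) b) := if_pos (by omega)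
      have h5 : b ≠ a + 1 := by omega
      simp [h1, h2, h3, h5, e, e', hab.ne]
  by_cases h3 : i.val + 2 = b
  · have e : swapPos n i (sab n a b) = sab n a (b - 1) := swapPos_sab_eq (by grind)
    have e' : Eab n a (b - 1) = eVec n (sab n a (b - 1)) := if_pos (by omega)
    simp [h2, h3, h4, e, e', hab.ne']
  · simp [h1, h2, h3, h4]

lemma sum_fin_ite_add_eq {M : Type*} [AddCommMonoid M] (n k c : ℕ) (v : M) :
    ∑ i : Fin n, (if i.val + k = c then v else 0) = if k ≤ c ∧ c < n + k then v else 0 := by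
  split_ifs with h
  · rw [Finset.sum_eq_single (⟨c - k, by omega⟩ : Fin n)]
    · exact if_pos (by simp; omega)
    · intro j _ hj
      exact if_neg fun hc => hj (Fin.ext (by simp; omega))
    · simp
  · exact Finset.sum_eq_zero fun i _ => if_neg (by omega)

lemma twistLaplacian_Eab {n a b : ℕ} (ha : 1 ≤ a) (hab : a < b) (hb : b ≤ n + 1) :
    twistLaplacian n (Eab n a b) =
      ((4 - (if a = 1 then 1 else 0) - (if b = n + 1 then 1 else 0)
          - (if b = a + 1 then 1 else 0) : ℂ)) • Eab n a b
        + Eab n (a - 1) b + Eab n (a + 1) b + Eab n a (b - 1) + Eab n a (b + 1) := by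
  rw [twistLaplacian, LinearMap.sum_apply, Finset.sum_congr rfl fun i _ => Aop_Eab ha hab hb i]
  simp only [Finset.sum_sub_distrib, Finset.sum_add_distrib, sum_fin_ite_add_eq]
  rw [if_pos (show 1 ≤ a ∧ a < n + 1 by omega), if_pos (show 1 ≤ a ∧ a < n + 1 by omega),
    if_pos (show 2 ≤ b ∧ b < n + 2 by omega)]
  have hleft : (if 2 ≤ a ∧ a < n + 2 then Eab n a b + Eab n (a - 1) b else 0) =
      (1 - (if a = 1 then 1 else 0) : ℂ) • Eab n a b + Eab n (a - 1) b := by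
    by_cases h : a = 1
    · have e : Eab n (a - 1) b = 0 := if_neg (by omega)
      rw [if_neg (by omega), e]
      simp [h]
    · rw [if_pos (by omega)]
      simp [h]
  have hright : (if 1 ≤ b ∧ b < n + 1 then Eab n a b + Eab n a (b + 1) else 0) =
      (1 - (if b = n + 1 then 1 else 0) : ℂ) • Eab n a b + Eab n a (b + 1) := by
    by_cases h : b = n + 1
    · have e : Eab n a (b + 1) = 0 := if_neg (by omega)
      rw [if_neg (by omega), e]
      simp [h]
    · rw [if_pos (by omega)]
      simp [h]
  have hadj : (if b = a + 1 then Eab n a b else 0) =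
      (if b = a + 1 then 1 else 0 : ℂ) • Eab n a b := by
    split_ifs <;> simp
  rw [hleft, hright, hadj]
  module

lemma Eab_mem_span (n a b : ℕ) :
    Eab n a b ∈ Submodule.span ℂ
      {v : TwistSpace n | ∃ a b : ℕ, 1 ≤ a ∧ a < b ∧ b ≤ n + 1 ∧ v = eVec n (sab n a b)} := by
  unfold Eab
  split_ifs with h
  · exact Submodule.subset_span ⟨a, b, h.1, h.2.1, h.2.2, rfl⟩
  · exact zero_mem _

lemma setOf_eVec_sab_eq_range (n : ℕ) :
    {v : TwistSpace n | ∃ a b : ℕ, 1 ≤ a ∧ a < b ∧ b ≤ n + 1 ∧ v = eVec n (sab n a b)} =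
      Set.range fun t : Finset.powersetCard 2 (Finset.univ : Finset (Fin (n + 1))) =>
        Pi.basisFun ℂ (Fin (n + 1) → Bool) fun j => decide (j ∈ t.val) := by
  have key (x y : Fin (n + 1)) :
      sab n (x.val + 1) (y.val + 1) = fun j => decide (j ∈ ({x, y} : Finset (Fin (n + 1)))) := by
    funext j
    simp [sab, Fin.ext_iff]
  ext v
  constructor
  · rintro ⟨a, b, ha, hab, hb, rfl⟩
    obtain ⟨x, rfl⟩ : ∃ x : Fin (n + 1), a = x.val + 1 := ⟨⟨a - 1, by omega⟩, by simp; omega⟩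
    obtain ⟨y, rfl⟩ : ∃ y : Fin (n + 1), b = y.val + 1 := ⟨⟨b - 1, by omega⟩, by simp; omega⟩
    have hxy : x ≠ y := fun h => by simp [h] at hab
    refine ⟨⟨{x, y}, by simp [Finset.mem_powersetCard, Finset.card_pair hxy]⟩, ?_⟩
    simp only [key, Pi.basisFun_apply, eVec]
  · rintro ⟨⟨t, ht⟩, rfl⟩
    obtain ⟨x, y, hxy, rfl⟩ := Finset.card_eq_two.mp (Finset.mem_powersetCard.mp ht).2
    simp only [Pi.basisFun_apply]
    rcases lt_or_gt_of_ne hxy with h | h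
    · exact ⟨x + 1, y + 1, by omega, by simpa using h, by omega, by rw [key]; rfl⟩
    · exact ⟨y + 1, x + 1, by omega, by simpa using h, by omega, by
        rw [key]; simp only [Finset.pair_comm y x]; rfl⟩

lemma finrank_span_eVec_sab (n : ℕ) :
    Module.finrank ℂ
        (Submodule.span ℂ
          {v : TwistSpace n | ∃ a b : ℕ, 1 ≤ a ∧ a < b ∧ b ≤ n + 1 ∧ v = eVec n (sab n a b)})
      = (n + 1).choose 2 := by
  rw [setOf_eVec_sab_eq_range, finrank_span_eq_card]
  · simp
  · refine (Pi.basisFun ℂ (Fin (n + 1) → Bool)).linearIndependent.comp _ fun t u h => ?_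
    ext j
    simpa using congrFun h j

/-- For every `n ≥ 1` and all `1 ≤ a < b ≤ n+1`,
`Δ e_{s_{a,b}} = (4 − δ_{a,1} − δ_{b,n+1} − δ_{b,a+1}) e_{s_{a,b}}
  + e_{s_{a−1,b}} + e_{s_{a+1,b}} + e_{s_{a,b−1}} + e_{s_{a,b+1}}`,
and in particular the span of the vectors `e_{s_{a,b}}`, which has dimension
`(n+1).choose 2`, is invariant under `Δ`. -/
theorem twistLaplacian_apply_sab (n : ℕ) (hn : 1 ≤ n) :
    (∀ a b : ℕ, 1 ≤ a → a < b → b ≤ n + 1 →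
      twistLaplacian n (Eab n a b) =
        ((4 - (if a = 1 then 1 else 0) - (if b = n + 1 then 1 else 0)
            - (if b = a + 1 then 1 else 0) : ℂ)) • Eab n a b
          + Eab n (a - 1) b + Eab n (a + 1) b + Eab n a (b - 1) + Eab n a (b + 1)) ∧
    Submodule.map (twistLaplacian n)
        (Submodule.span ℂ
          {v : TwistSpace n | ∃ a b : ℕ, 1 ≤ a ∧ a < b ∧ b ≤ n + 1 ∧ v = eVec n (sab n a b)})
      ≤ Submodule.span ℂ
          {v : TwistSpace n | ∃ a b : ℕ, 1 ≤ a ∧ a < b ∧ b ≤ n + 1 ∧ v = eVec n (sab n a b)} ∧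
    Module.finrank ℂ
        (Submodule.span ℂ
          {v : TwistSpace n | ∃ a b : ℕ, 1 ≤ a ∧ a < b ∧ b ≤ n + 1 ∧ v = eVec n (sab n a b)})
      = (n + 1).choose 2 := by
  refine ⟨fun a b ha hab hb => twistLaplacian_Eab ha hab hb, ?_, finrank_span_eVec_sab n⟩
  rw [Submodule.map_span_le]
  rintro _ ⟨a, b, ha, hab, hb, rfl⟩
  have hE : eVec n (sab n a b) = Eab n a b := (if_pos ⟨ha, hab, hb⟩).symm
  rw [hE, twistLaplacian_Eab ha hab hb]
  have hmem := Eab_mem_span n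
  exact add_mem (add_mem (add_mem (add_mem (Submodule.smul_mem _ _ (hmem _ _)) (hmem _ _))
    (hmem _ _)) (hmem _ _)) (hmem _ _)

end
end

section
/- For every n ≥ 1, every eigenvalue λ of the matrix M_n satisfies λ ≥ 1/(16(n+1)²) — equivalently ⟨x, M_n x⟩ ≥ (1/(16(n+1)²))·‖x‖² for all x — and the smallest eigenvalue of M_n is at most 4/(n+1) — equivalently there is a nonzero x with ⟨x, M_n x⟩ ≤ (4/(n+1))·‖x‖². In particular M_n is positive definite and its smallest eigenvalue decays at most polynomially (not exponentially) in n. -/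
noncomputable section

/-- The index set `P_n = {(a,b) : 1 ≤ a < b ≤ n+1}` (realized inside `Fin (n+2) × Fin (n+2)`). -/
abbrev PairIdx (n : ℕ) :=
  {p : Fin (n + 2) × Fin (n + 2) // 1 ≤ p.1.val ∧ p.1.val < p.2.val ∧ p.2.val ≤ n + 1}

/-- The symmetric matrix `M_n` indexed by `P_n`, with diagonal entries
`4 − δ_{a,1} − δ_{b,n+1} − δ_{b,a+1}` and off-diagonal entry `1` exactly between
neighbouring pairs `(a±1, b)`, `(a, b±1)`.  It is the Khovanov Hodge Laplacian of the
twisted unknot `TU_n` in bidegree `(0, 3−n)`. -/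
def Mmat (n : ℕ) : PairIdx n → PairIdx n → ℝ := fun p q =>
  if p = q then
    4 - (if p.1.1.val = 1 then 1 else 0) - (if p.1.2.val = n + 1 then 1 else 0)
      - (if p.1.2.val = p.1.1.val + 1 then 1 else 0)
  else if (q.1.1.val = p.1.1.val - 1 ∧ q.1.2.val = p.1.2.val) ∨
          (q.1.1.val = p.1.1.val + 1 ∧ q.1.2.val = p.1.2.val) ∨
          (q.1.1.val = p.1.1.val ∧ q.1.2.val = p.1.2.val - 1) ∨
          (q.1.1.val = p.1.1.val ∧ q.1.2.val = p.1.2.val + 1) then 1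
  else 0

/-- The extension by zero of a function on `PairIdx n` to all pairs of natural numbers. -/
def pairExtend {n : ℕ} (x : PairIdx n → ℝ) (c d : ℕ) : ℝ :=
  ∑ q : PairIdx n, if q.1.1.val = c ∧ q.1.2.val = d then x q else 0

theorem pairExtend_apply {n : ℕ} (x : PairIdx n → ℝ) (p : PairIdx n) :
    pairExtend x p.1.1.val p.1.2.val = x p := by
  unfold pairExtend
  rw [Finset.sum_eq_single p]
  · simp
  · intro q _ hq
    rw [if_neg]
    rintro ⟨h1, h2⟩
    exact hq (Subtype.ext (Prod.ext (Fin.ext h1) (Fin.ext h2)))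
  · simp

theorem pairExtend_eq_zero {n : ℕ} (x : PairIdx n → ℝ) {c d : ℕ}
    (h : ¬ (1 ≤ c ∧ c < d ∧ d ≤ n + 1)) : pairExtend x c d = 0 := by
  unfold pairExtend
  refine Finset.sum_eq_zero fun q _ => if_neg ?_
  rintro ⟨rfl, rfl⟩
  exact h q.2

theorem pairExtend_comp {n : ℕ} (f : ℕ → ℕ → ℝ) (c d : ℕ) :
    pairExtend (fun p : PairIdx n => f p.1.1.val p.1.2.val) c d =
      if 1 ≤ c ∧ c < d ∧ d ≤ n + 1 then f c d else 0 := by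
  split_ifs with h
  · exact pairExtend_apply (fun p : PairIdx n => f p.1.1.val p.1.2.val)
      ⟨(⟨c, by omega⟩, ⟨d, by omega⟩), h⟩
  · exact pairExtend_eq_zero _ h

theorem sum_pairIdx {n : ℕ} (f : ℕ → ℕ → ℝ) :
    ∑ p : PairIdx n, f p.1.1.val p.1.2.val =
      ∑ a ∈ Finset.range (n + 2), ∑ b ∈ Finset.range (n + 2),
        if 1 ≤ a ∧ a < b ∧ b ≤ n + 1 then f a b else 0 := by
  rw [← Finset.sum_subtype (Finset.univ.filter fun p : Fin (n + 2) × Fin (n + 2) =>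
      1 ≤ p.1.val ∧ p.1.val < p.2.val ∧ p.2.val ≤ n + 1) (by simp)
    (fun p => f p.1.val p.2.val), Finset.sum_filter, Fintype.sum_prod_type, Finset.sum_range]
  refine Finset.sum_congr rfl fun a _ => ?_
  rw [Finset.sum_range]

/-- The diagonal entry of `M_n` at the pair `(a, b)`. -/
def pairDiag (n a b : ℕ) : ℝ :=
  4 - (if a = 1 then 1 else 0) - (if b = n + 1 then 1 else 0) - (if b = a + 1 then 1 else 0)

theorem Mmat_mul_eq {n : ℕ} (x : PairIdx n → ℝ) (p q : PairIdx n) :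
    Mmat n p q * x q =
      pairDiag n p.1.1.val p.1.2.val *
        (if q.1.1.val = p.1.1.val ∧ q.1.2.val = p.1.2.val then x q else 0) +
      (if q.1.1.val = p.1.1.val - 1 ∧ q.1.2.val = p.1.2.val then x q else 0) +
      (if q.1.1.val = p.1.1.val + 1 ∧ q.1.2.val = p.1.2.val then x q else 0) +
      (if q.1.1.val = p.1.1.val ∧ q.1.2.val = p.1.2.val - 1 then x q else 0) +
      (if q.1.1.val = p.1.1.val ∧ q.1.2.val = p.1.2.val + 1 then x q else 0) := by
  have hpq : p = q ↔ q.1.1.val = p.1.1.val ∧ q.1.2.val = p.1.2.val := by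
    rw [Subtype.ext_iff, Prod.ext_iff, Fin.ext_iff, Fin.ext_iff]
    omega
  obtain ⟨h1, h2, h3⟩ := p.2
  unfold Mmat
  simp only [hpq]
  rw [← pairDiag]
  generalize p.1.1.val = a at *
  generalize p.1.2.val = b at *
  generalize q.1.1.val = c at *
  generalize q.1.2.val = d at *
  by_cases e0 : c = a ∧ d = b
  · rw [if_pos e0, if_pos e0, if_neg (by omega), if_neg (by omega), if_neg (by omega),
      if_neg (by omega)]
    ring
  rw [if_neg e0, if_neg e0]
  by_cases e1 : c = a - 1 ∧ d = b
  · rw [if_pos (by omega), if_pos e1, if_neg (by omega), if_neg (by omega), if_neg (by omega)]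
    ring
  by_cases e2 : c = a + 1 ∧ d = b
  · rw [if_pos (by omega), if_neg e1, if_pos e2, if_neg (by omega), if_neg (by omega)]
    ring
  by_cases e3 : c = a ∧ d = b - 1
  · rw [if_pos (by omega), if_neg e1, if_neg e2, if_pos e3, if_neg (by omega)]
    ring
  by_cases e4 : c = a ∧ d = b + 1
  · rw [if_pos (by omega), if_neg e1, if_neg e2, if_neg e3, if_pos e4]
    ring
  · rw [if_neg (by omega), if_neg e1, if_neg e2, if_neg e3, if_neg e4]
    ring

theorem sum_Mmat_mul {n : ℕ} (x : PairIdx n → ℝ) (p : PairIdx n) :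
    ∑ q, x p * Mmat n p q * x q =
      pairExtend x p.1.1.val p.1.2.val *
        (pairDiag n p.1.1.val p.1.2.val * pairExtend x p.1.1.val p.1.2.val +
          pairExtend x (p.1.1.val - 1) p.1.2.val + pairExtend x (p.1.1.val + 1) p.1.2.val +
          pairExtend x p.1.1.val (p.1.2.val - 1) + pairExtend x p.1.1.val (p.1.2.val + 1)) := by
  simp_rw [mul_assoc, Mmat_mul_eq, ← Finset.mul_sum, Finset.sum_add_distrib, ← Finset.mul_sum]
  rw [pairExtend_apply x p]
  congr 4
  congr 2
  exact pairExtend_apply x p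

/-- Summation by parts for the path with vertices `0, …, N` and a zero at `0`. -/
theorem sum_path_eq (u : ℕ → ℝ) (h0 : u 0 = 0) (N : ℕ) :
    ∑ b ∈ Finset.range (N + 1), u b * (2 * u b + u (b - 1) + u (b + 1)) =
      ∑ b ∈ Finset.range N, (u b + u (b + 1)) ^ 2 + u N ^ 2 + u N * u (N + 1) := by
  induction N with
  | zero => simp [h0]
  | succ N ih =>
    rw [Finset.sum_range_succ, ih, Finset.sum_range_succ, Nat.add_sub_cancel]
    ring

/-- A pointwise Poincaré inequality for the signless Laplacian of a path. -/
theorem sq_le_mul_sum_path (u : ℕ → ℝ) (h0 : u 0 = 0) (k : ℕ) :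
    u k ^ 2 ≤ k * ∑ i ∈ Finset.range k, (u i + u (i + 1)) ^ 2 := by
  induction k with
  | zero => simp [h0]
  | succ k ih =>
    rw [Finset.sum_range_succ]
    rcases Nat.eq_zero_or_pos k with rfl | hk
    · simp [h0]
    have hk' : (0 : ℝ) < k := by exact_mod_cast hk
    push_cast
    generalize ∑ i ∈ Finset.range k, (u i + u (i + 1)) ^ 2 = S at *
    generalize u k = v at *
    generalize u (k + 1) = w at *
    have key : 0 ≤ (k : ℝ) * (((k : ℝ) + 1) * (S + (v + w) ^ 2) - w ^ 2) := by
      nlinarith [sq_nonneg ((k : ℝ) * (v + w) + v)]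
    linarith [nonneg_of_mul_nonneg_right key hk']

theorem sum_sq_le_sum_path (u : ℕ → ℝ) (h0 : u 0 = 0) (N : ℕ) :
    ∑ b ∈ Finset.range (N + 1), u b ^ 2 ≤
      ((N + 1) * N : ℝ) * ∑ i ∈ Finset.range N, (u i + u (i + 1)) ^ 2 := by
  calc ∑ b ∈ Finset.range (N + 1), u b ^ 2
      ≤ ∑ _b ∈ Finset.range (N + 1), (N : ℝ) * ∑ i ∈ Finset.range N, (u i + u (i + 1)) ^ 2 := by
        refine Finset.sum_le_sum fun b hb => (sq_le_mul_sum_path u h0 b).trans ?_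
        have hb' : b ≤ N := Nat.lt_succ_iff.mp (Finset.mem_range.mp hb)
        gcongr
    _ = _ := by
        rw [Finset.sum_const, Finset.card_range, nsmul_eq_mul]
        push_cast
        ring

/-- The first-coordinate part of the quadratic form of `M_n` is nonnegative. -/
theorem path_form_nonneg (v : ℕ → ℝ) (N b : ℕ) (hb : b ≤ N)
    (hv : ∀ a, ¬ (1 ≤ a ∧ a < b) → v a = 0) :
    0 ≤ ∑ a ∈ Finset.range (N + 1), v a *
      ((2 - (if a = 1 then 1 else 0) - (if b = a + 1 then 1 else 0)) * v a +
        v (a - 1) + v (a + 1)) := by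
  by_cases hb2 : b < 2
  · refine (Finset.sum_eq_zero fun a _ => ?_).ge
    rw [hv a (by omega), zero_mul]
  obtain ⟨c, rfl⟩ : ∃ c, b = c + 1 := ⟨b - 1, by omega⟩
  have hsplit : ∑ a ∈ Finset.range (N + 1), v a *
      ((2 - (if a = 1 then 1 else 0) - (if c + 1 = a + 1 then 1 else 0)) * v a +
        v (a - 1) + v (a + 1)) =
      ∑ a ∈ Finset.range (N + 1), v a * (2 * v a + v (a - 1) + v (a + 1)) -
        v 1 ^ 2 - v c ^ 2 := by
    have h1 : ∑ a ∈ Finset.range (N + 1), (if a = 1 then v a ^ 2 else 0) = v 1 ^ 2 := by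
      rw [Finset.sum_ite_eq', if_pos (by rw [Finset.mem_range]; omega)]
    have h2 : ∑ a ∈ Finset.range (N + 1), (if a = c then v a ^ 2 else 0) = v c ^ 2 := by
      rw [Finset.sum_ite_eq', if_pos (by rw [Finset.mem_range]; omega)]
    rw [← h1, ← h2, ← Finset.sum_sub_distrib, ← Finset.sum_sub_distrib]
    refine Finset.sum_congr rfl fun a _ => ?_
    simp only [add_left_inj, eq_comm (a := c)]
    split_ifs <;> ring
  have hsub : ∑ a ∈ ({0, c} : Finset ℕ), (v a + v (a + 1)) ^ 2 ≤
      ∑ a ∈ Finset.range N, (v a + v (a + 1)) ^ 2 := by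
    refine Finset.sum_le_sum_of_subset_of_nonneg ?_ fun a _ _ => sq_nonneg _
    intro a ha
    simp only [Finset.mem_insert, Finset.mem_singleton] at ha
    rw [Finset.mem_range]
    omega
  rw [Finset.sum_pair (by omega), hv 0 (by omega), hv (c + 1) (by omega)] at hsub
  rw [hsplit, sum_path_eq v (hv 0 (by omega)), hv N (by omega)]
  simp only [zero_add, add_zero] at hsub
  linarith

theorem Mmat_form_eq {n : ℕ} (x : PairIdx n → ℝ) :
    ∑ p, ∑ q, x p * Mmat n p q * x q =
      ∑ a ∈ Finset.range (n + 2), ∑ b ∈ Finset.range (n + 2), pairExtend x a b *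
        ((2 - (if a = 1 then 1 else 0) - (if b = a + 1 then 1 else 0)) * pairExtend x a b +
          pairExtend x (a - 1) b + pairExtend x (a + 1) b) +
      ∑ a ∈ Finset.range (n + 2), ∑ b ∈ Finset.range (n + 1),
        (pairExtend x a b + pairExtend x a (b + 1)) ^ 2 := by
  have hpath (a : ℕ) : ∑ b ∈ Finset.range (n + 1),
      (pairExtend x a b + pairExtend x a (b + 1)) ^ 2 =
      ∑ b ∈ Finset.range (n + 2), pairExtend x a b *
        ((2 - (if b = n + 1 then 1 else 0)) * pairExtend x a b +
          pairExtend x a (b - 1) + pairExtend x a (b + 1)) := by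
    have h := sum_path_eq (pairExtend x a) (pairExtend_eq_zero x (by omega)) (n + 1)
    rw [pairExtend_eq_zero x (d := n + 1 + 1) (by omega)] at h
    have h1 : ∑ b ∈ Finset.range (n + 2), (if b = n + 1 then pairExtend x a b ^ 2 else 0) =
        pairExtend x a (n + 1) ^ 2 := by
      rw [Finset.sum_ite_eq', if_pos (by rw [Finset.mem_range]; omega)]
    rw [mul_zero, add_zero, ← h1, ← sub_eq_iff_eq_add, ← Finset.sum_sub_distrib] at h
    rw [← h]
    refine Finset.sum_congr rfl fun b _ => ?_
    split_ifs <;> ring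
  simp_rw [sum_Mmat_mul, hpath]
  rw [sum_pairIdx (fun a b => pairExtend x a b * (pairDiag n a b * pairExtend x a b +
    pairExtend x (a - 1) b + pairExtend x (a + 1) b +
    pairExtend x a (b - 1) + pairExtend x a (b + 1)))]
  simp_rw [← Finset.sum_add_distrib]
  refine Finset.sum_congr rfl fun a _ => Finset.sum_congr rfl fun b _ => ?_
  by_cases h : 1 ≤ a ∧ a < b ∧ b ≤ n + 1
  · rw [if_pos h, pairDiag]
    ring
  · rw [if_neg h, pairExtend_eq_zero x h]
    ring

theorem sum_sq_eq_sum_pairExtend {n : ℕ} (x : PairIdx n → ℝ) :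
    ∑ p, x p ^ 2 =
      ∑ a ∈ Finset.range (n + 2), ∑ b ∈ Finset.range (n + 2), pairExtend x a b ^ 2 := by
  rw [← Finset.sum_congr rfl fun p _ => congrArg (· ^ 2) (pairExtend_apply x p),
    sum_pairIdx fun a b => pairExtend x a b ^ 2]
  refine Finset.sum_congr rfl fun a _ => Finset.sum_congr rfl fun b _ => ?_
  split_ifs with h
  · rfl
  · rw [pairExtend_eq_zero x h, zero_pow two_ne_zero]

theorem sum_sq_le_Mmat_form {n : ℕ} (x : PairIdx n → ℝ) :
    ∑ p, x p ^ 2 ≤ ((n + 2) * (n + 1) : ℝ) * ∑ p, ∑ q, x p * Mmat n p q * x q := by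
  have hv : ∑ p, x p ^ 2 ≤ ((n + 2) * (n + 1) : ℝ) *
      ∑ a ∈ Finset.range (n + 2), ∑ b ∈ Finset.range (n + 1),
        (pairExtend x a b + pairExtend x a (b + 1)) ^ 2 := by
    rw [sum_sq_eq_sum_pairExtend, Finset.mul_sum]
    refine Finset.sum_le_sum fun a _ => ?_
    have h := sum_sq_le_sum_path (pairExtend x a) (pairExtend_eq_zero x (by omega)) (n + 1)
    rw [Nat.cast_add_one, add_assoc (n : ℝ), one_add_one_eq_two] at h
    exact h
  refine hv.trans ?_
  rw [Mmat_form_eq]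
  refine mul_le_mul_of_nonneg_left (le_add_of_nonneg_left ?_) (by positivity)
  rw [Finset.sum_comm]
  refine Finset.sum_nonneg fun b hb => ?_
  have hbN : b ≤ n + 1 := Nat.lt_succ_iff.mp (Finset.mem_range.mp hb)
  exact path_form_nonneg (fun a => pairExtend x a b) (n + 1) b hbN
    fun a ha => pairExtend_eq_zero x fun h => ha ⟨h.1, h.2.1⟩

/-- The alternating vector, constant up to the sign of the bipartition of the grid. -/
def alternatingVec (n : ℕ) : PairIdx n → ℝ := fun p => (-1) ^ (p.1.1.val + p.1.2.val)

theorem alternatingVec_sq {n : ℕ} (p : PairIdx n) : alternatingVec n p ^ 2 = 1 := by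
  rw [alternatingVec, ← pow_mul, mul_comm, pow_mul, neg_one_sq, one_pow]

theorem alternatingVec_form {n : ℕ} (p : PairIdx n) :
    ∑ q, alternatingVec n p * Mmat n p q * alternatingVec n q =
      if p.1.2.val = p.1.1.val + 1 then 1 else 0 := by
  have hX (c d : ℕ) : pairExtend (alternatingVec n) c d =
      if 1 ≤ c ∧ c < d ∧ d ≤ n + 1 then (-1) ^ (c + d) else 0 :=
    pairExtend_comp (fun c d => (-1) ^ (c + d)) c d
  rw [sum_Mmat_mul]
  simp only [hX]
  have hp := p.2
  obtain ⟨a, ha⟩ : ∃ a, p.1.1.val = a + 1 := ⟨p.1.1.val - 1, by omega⟩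
  obtain ⟨b, hb⟩ : ∃ b, p.1.2.val = b + 1 := ⟨p.1.2.val - 1, by omega⟩
  rw [ha, hb] at hp ⊢
  simp only [Nat.add_sub_cancel]
  rw [if_pos hp, pairDiag]
  have hs : ((-1 : ℝ) ^ (a + b)) ^ 2 = 1 := by
    rw [← pow_mul, mul_comm, pow_mul, neg_one_sq, one_pow]
  have e0 : (-1 : ℝ) ^ (a + 1 + (b + 1)) = (-1) ^ (a + b) := by ring
  have e1 : (-1 : ℝ) ^ (a + (b + 1)) = -(-1) ^ (a + b) := by ring
  have e2 : (-1 : ℝ) ^ (a + 1 + 1 + (b + 1)) = -(-1) ^ (a + b) := by ring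
  have e3 : (-1 : ℝ) ^ (a + 1 + b) = -(-1) ^ (a + b) := by ring
  have e4 : (-1 : ℝ) ^ (a + 1 + (b + 1 + 1)) = -(-1) ^ (a + b) := by ring
  rw [e0, e1, e2, e3, e4]
  generalize (-1 : ℝ) ^ (a + b) = s at *
  have c1 : (1 ≤ a ∧ a < b + 1 ∧ b + 1 ≤ n + 1) ↔ ¬ (a + 1 = 1) := by omega
  have c2 : (1 ≤ a + 1 + 1 ∧ a + 1 + 1 < b + 1 ∧ b + 1 ≤ n + 1) ↔ ¬ (b + 1 = a + 1 + 1) := by omega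
  have c3 : (1 ≤ a + 1 ∧ a + 1 < b ∧ b ≤ n + 1) ↔ ¬ (b + 1 = a + 1 + 1) := by omega
  have c4 : (1 ≤ a + 1 ∧ a + 1 < b + 1 + 1 ∧ b + 1 + 1 ≤ n + 1) ↔ ¬ (b + 1 = n + 1) := by omega
  simp only [c1, c2, c3, c4, ite_not]
  split_ifs <;> ring_nf <;> simp [hs]

theorem sum_pairIdx_one (n : ℕ) : ∑ _p : PairIdx n, (1 : ℝ) = n * (n + 1) / 2 := by
  have hcount (b : ℕ) (hb : b ∈ Finset.range (n + 1)) : ∑ a ∈ Finset.range (n + 2),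
      (if 1 ≤ a ∧ a < b + 1 ∧ b + 1 ≤ n + 1 then (1 : ℝ) else 0) = b := by
    rw [Finset.mem_range] at hb
    have hset : {a ∈ Finset.range (n + 2) | 1 ≤ a ∧ a < b + 1 ∧ b + 1 ≤ n + 1} =
        Finset.Icc 1 b := by
      ext a
      simp only [Finset.mem_filter, Finset.mem_range, Finset.mem_Icc]
      omega
    rw [← Finset.sum_filter, hset]
    simp
  have hgauss : (∑ b ∈ Finset.range (n + 1), (b : ℝ)) * 2 = (n + 1) * n := by
    have h := congrArg (Nat.cast : ℕ → ℝ) (Finset.sum_range_id_mul_two (n + 1))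
    rw [Nat.add_sub_cancel] at h
    push_cast at h
    exact h
  rw [sum_pairIdx fun _ _ => 1, Finset.sum_comm, Finset.sum_range_succ',
    Finset.sum_congr rfl hcount]
  simp only [not_lt_zero, false_and, and_false, if_false, Finset.sum_const_zero]
  linarith

theorem sum_pairIdx_succ (n : ℕ) :
    ∑ p : PairIdx n, (if p.1.2.val = p.1.1.val + 1 then (1 : ℝ) else 0) = n := by
  have hrow (a : ℕ) (ha : a ∈ Finset.range (n + 2)) : (∑ b ∈ Finset.range (n + 2),
      if 1 ≤ a ∧ a < b ∧ b ≤ n + 1 then (if b = a + 1 then (1 : ℝ) else 0) else 0) =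
      if a ∈ Finset.Icc 1 n then 1 else 0 := by
    rw [Finset.sum_eq_single (a + 1)]
    · simp only [Finset.mem_Icc, if_true]
      refine if_congr ?_ rfl rfl
      omega
    · intro b _ hb
      simp [hb]
    · intro h
      rw [Finset.mem_range] at h
      rw [if_neg (by omega)]
  have hset : {a ∈ Finset.range (n + 2) | a ∈ Finset.Icc 1 n} = Finset.Icc 1 n := by
    ext a
    simp only [Finset.mem_filter, Finset.mem_range, Finset.mem_Icc]
    omega
  rw [sum_pairIdx fun a b => if b = a + 1 then 1 else 0, Finset.sum_congr rfl hrow,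
    ← Finset.sum_filter, hset]
  simp

/-- For every `n ≥ 1`: every eigenvalue of `M_n` is at least `1/(16(n+1)²)` — equivalently
`⟨x, M_n x⟩ ≥ (1/(16(n+1)²))·‖x‖²` for all `x` — and the smallest eigenvalue of `M_n` is at
most `4/(n+1)` — equivalently some nonzero `x` has `⟨x, M_n x⟩ ≤ (4/(n+1))·‖x‖²`.  In
particular `M_n` is positive definite and its smallest eigenvalue decays at most
polynomially in `n`. -/
theorem Mmat_eigenvalue_bounds (n : ℕ) (hn : 1 ≤ n) :
    (∀ x : PairIdx n → ℝ,
      (1 / (16 * ((n : ℝ) + 1) ^ 2)) * ∑ p, (x p) ^ 2 ≤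
        ∑ p, ∑ q, x p * Mmat n p q * x q) ∧
    (∃ x : PairIdx n → ℝ, x ≠ 0 ∧
      ∑ p, ∑ q, x p * Mmat n p q * x q ≤ (4 / ((n : ℝ) + 1)) * ∑ p, (x p) ^ 2) := by
  constructor
  · intro x
    have h := sum_sq_le_Mmat_form x
    have hQ : 0 ≤ ∑ p, ∑ q, x p * Mmat n p q * x q :=
      nonneg_of_mul_nonneg_right ((Finset.sum_nonneg fun p _ => sq_nonneg (x p)).trans h)
        (by positivity)
    rw [one_div, inv_mul_le_iff₀ (by positivity)]
    refine h.trans (mul_le_mul_of_nonneg_right ?_ hQ)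
    nlinarith [(Nat.cast_nonneg n : (0 : ℝ) ≤ n)]
  · refine ⟨alternatingVec n, fun h => ?_, ?_⟩
    · have h1 := alternatingVec_sq (n := n) ⟨(⟨1, by omega⟩, ⟨2, by omega⟩), by simp; omega⟩
      rw [h] at h1
      simp at h1
    · simp_rw [alternatingVec_form, alternatingVec_sq]
      rw [sum_pairIdx_succ, sum_pairIdx_one]
      have hn0 : (0 : ℝ) ≤ n := Nat.cast_nonneg n
      field_simp
      linarith

end
end

section
/- For every N ≥ 0 and 0 ≤ k ≤ N+1, the simple graph G_{N,k} on k-element subsets of {1,…,N+1}, whose edges swap the membership of an adjacent pair i, i+1, is connected and bipartite (admits a proper 2-coloring, equivalently contains no odd cycle). -/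
/-- The simple graph `G_{N,k}` on the `k`-element subsets of `{1, …, N+1}` (realized as
`Fin (N+1)`): `S` and `T` are adjacent iff there is `1 ≤ i ≤ N` such that exactly one of
`i, i+1` lies in `S` and `T = S Δ {i, i+1}` (membership of `i` and `i+1` swapped). -/
def twistGraph (N k : ℕ) : SimpleGraph {S : Finset (Fin (N + 1)) // S.card = k} :=
  SimpleGraph.fromRel fun S T =>
    ∃ i : Fin N,
      ((i.castSucc ∈ S.1 ∧ i.succ ∉ S.1) ∨ (i.castSucc ∉ S.1 ∧ i.succ ∈ S.1)) ∧
      T.1 = symmDiff S.1 {i.castSucc, i.succ}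

theorem Finset.symmDiff_pair_of_notMem_of_mem {α : Type*} [DecidableEq α] {S : Finset α} {a b : α}
    (ha : a ∉ S) (hb : b ∈ S) : symmDiff S {a, b} = insert a (S.erase b) := by
  ext x
  simp only [Finset.mem_symmDiff, Finset.mem_insert, Finset.mem_singleton, Finset.mem_erase]
  grind

theorem Finset.sum_symmDiff_pair_add {α M : Type*} [DecidableEq α] [AddCommMonoid M]
    {S : Finset α} {a b : α} (ha : a ∉ S) (hb : b ∈ S) (f : α → M) :
    ∑ x ∈ symmDiff S {a, b}, f x + f b = ∑ x ∈ S, f x + f a := by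
  rw [Finset.symmDiff_pair_of_notMem_of_mem ha hb,
    Finset.sum_insert (fun h => ha (Finset.mem_of_mem_erase h)), add_assoc,
    Finset.sum_erase_add _ _ hb, add_comm]

theorem Fin.isLowerSet_of_castSucc_mem {N : ℕ} {s : Set (Fin (N + 1))}
    (h : ∀ i : Fin N, i.succ ∈ s → i.castSucc ∈ s) : IsLowerSet s := by
  intro j i hij hj
  induction j using Fin.induction with
  | zero => rwa [Fin.le_zero_iff.mp hij]
  | succ j ih =>
    rcases hij.eq_or_lt with rfl | hlt
    · exact hj
    · exact ih (Fin.le_castSucc_iff.mpr hlt) (h j hj)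

theorem twistGraph_exists_reachable_isLowerSet {N k : ℕ}
    (S : {S : Finset (Fin (N + 1)) // S.card = k}) :
    ∃ T, (twistGraph N k).Reachable S T ∧ IsLowerSet (T.1 : Set (Fin (N + 1))) := by
  induction hn : ∑ x ∈ S.1, (x : ℕ) using Nat.strong_induction_on generalizing S with
  | _ n ih =>
    by_cases h : ∀ i : Fin N, i.succ ∈ S.1 → i.castSucc ∈ S.1
    · exact ⟨S, SimpleGraph.Reachable.refl S, Fin.isLowerSet_of_castSucc_mem (by simpa using h)⟩
    · push Not at h
      obtain ⟨i, hi, hi'⟩ := h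
      have hsum := Finset.sum_symmDiff_pair_add hi' hi (fun x => (x : ℕ))
      have hcard := Finset.sum_symmDiff_pair_add hi' hi (fun _ => 1)
      simp only [Finset.sum_const, smul_eq_mul, mul_one, Nat.add_right_cancel_iff] at hcard
      simp only [Fin.val_succ, Fin.val_castSucc] at hsum
      let T : {S : Finset (Fin (N + 1)) // S.card = k} :=
        ⟨symmDiff S.1 {i.castSucc, i.succ}, hcard.trans S.2⟩
      have hST : (twistGraph N k).Adj S T := by
        rw [twistGraph, SimpleGraph.fromRel_adj]
        refine ⟨?_, Or.inl ⟨i, Or.inr ⟨hi', hi⟩, rfl⟩⟩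
        intro he
        have : ∑ x ∈ S.1, (x : ℕ) = ∑ x ∈ T.1, (x : ℕ) := by rw [← he]
        simp only [T] at this
        omega
      obtain ⟨U, hU, hlow⟩ := ih (∑ x ∈ T.1, (x : ℕ)) (by simp only [T]; omega) T rfl
      exact ⟨U, hST.reachable.trans hU, hlow⟩

theorem twistGraph_preconnected (N k : ℕ) : (twistGraph N k).Preconnected := by
  intro S T
  obtain ⟨U, hSU, hU⟩ := twistGraph_exists_reachable_isLowerSet S
  obtain ⟨V, hTV, hV⟩ := twistGraph_exists_reachable_isLowerSet T
  have hUV : U = V := by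
    apply Subtype.ext
    rcases hU.total hV with h | h
    · exact Finset.eq_of_subset_of_card_le (Finset.coe_subset.mp h) (V.2.trans U.2.symm).le
    · exact (Finset.eq_of_subset_of_card_le (Finset.coe_subset.mp h) (U.2.trans V.2.symm).le).symm
  subst hUV
  exact hSU.trans hTV.symm

theorem sum_ne_sum_symmDiff_castSucc_succ {N : ℕ} {S : Finset (Fin (N + 1))} {i : Fin N}
    (h : (i.castSucc ∈ S ∧ i.succ ∉ S) ∨ (i.castSucc ∉ S ∧ i.succ ∈ S)) :
    ((∑ x ∈ S, (x : ℕ) : ℕ) : ZMod 2) ≠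
      ((∑ x ∈ symmDiff S {i.castSucc, i.succ}, (x : ℕ) : ℕ) : ZMod 2) := by
  rw [Ne, ZMod.natCast_eq_natCast_iff']
  rcases h with ⟨h1, h2⟩ | ⟨h1, h2⟩
  · have := Finset.sum_symmDiff_pair_add h2 h1 (fun x => (x : ℕ))
    rw [Finset.pair_comm] at this
    simp only [Fin.val_succ, Fin.val_castSucc] at this
    omega
  · have := Finset.sum_symmDiff_pair_add h1 h2 (fun x => (x : ℕ))
    simp only [Fin.val_succ, Fin.val_castSucc] at this
    omega

theorem twistGraph_colorable_two (N k : ℕ) : (twistGraph N k).Colorable 2 := by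
  let C : (twistGraph N k).Coloring (ZMod 2) :=
    SimpleGraph.Coloring.mk (fun S => ((∑ x ∈ S.1, (x : ℕ) : ℕ) : ZMod 2)) (by
      intro S T hST
      rw [twistGraph, SimpleGraph.fromRel_adj] at hST
      obtain ⟨-, ⟨i, hi, hT⟩ | ⟨i, hi, hS⟩⟩ := hST
      · rw [hT]
        exact sum_ne_sum_symmDiff_castSucc_succ hi
      · rw [hS]
        exact (sum_ne_sum_symmDiff_castSucc_succ hi).symm)
  simpa [ZMod.card] using C.colorable

/-- For every `N ≥ 0` and `0 ≤ k ≤ N+1`, the graph `G_{N,k}` is connected and bipartite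
(2-colorable, equivalently with no odd cycle). -/
theorem twistGraph_connected_and_bipartite (N k : ℕ) (hk : k ≤ N + 1) :
    (twistGraph N k).Connected ∧ (twistGraph N k).Colorable 2 := by
  obtain ⟨S, -, hS⟩ := Finset.exists_subset_card_eq
    (s := (Finset.univ : Finset (Fin (N + 1)))) (n := k) (by simpa using hk)
  have : Nonempty {S : Finset (Fin (N + 1)) // S.card = k} := ⟨⟨S, hS⟩⟩
  exact ⟨⟨twistGraph_preconnected N k⟩, twistGraph_colorable_two N k⟩
end

section
/- Let (V, w) be a weighted graph with V nonempty and let Q = D + A be its signless Laplace matrix. Then the smallest eigenvalue of Q is at most 4Ψ: there exists a nonzero real vector x indexed by V with xᵀ Q x ≤ 4Ψ · ‖x‖². -/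
/-- The total loop weight `loop(S) = Σ_{v ∈ S} w(v,v)`. -/
def loopW {V : Type*} (w : V → V → ℝ) (S : Finset V) : ℝ := ∑ v ∈ S, w v v

/-- The cut weight `cut(S) = Σ_{v ∈ S, u ∉ S} w(v,u)`. -/
def cutW {V : Type*} [Fintype V] [DecidableEq V] (w : V → V → ℝ) (S : Finset V) : ℝ :=
  ∑ v ∈ S, ∑ u ∈ Sᶜ, w v u

/-- `e_min(S)`: the minimum, over two-colorings `c` of the vertices, of the total weight of
all loops in `S` plus the weight of all monochromatic (non-loop) edges inside `S` — the
minimum total weight of edges whose removal from the induced subgraph on `S` leaves a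
bipartite graph. -/
noncomputable def eminW {V : Type*} [Fintype V] [DecidableEq V] (w : V → V → ℝ)
    (S : Finset V) : ℝ :=
  ⨅ c : V → Bool,
    (loopW w S + (1 / 2) * ∑ v ∈ S, ∑ u ∈ S, (if v ≠ u ∧ c v = c u then w v u else 0))

/-- `Ψ = min over nonempty S ⊆ V of (e_min(S) + cut(S)) / |S|`. -/
noncomputable def PsiW {V : Type*} [Fintype V] [DecidableEq V] [Nonempty V]
    (w : V → V → ℝ) : ℝ :=
  ⨅ S : {S : Finset V // S.Nonempty}, (eminW w S.1 + cutW w S.1) / (S.1.card : ℝ)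

/-- The signless Laplace quadratic form as a sum over ordered pairs of vertices. -/
theorem signless_laplacian_quadratic_form {V : Type*} [Fintype V] [DecidableEq V]
    (w : V → V → ℝ) (x : V → ℝ) :
    ∑ v, ∑ u, x v * ((if v = u then ∑ z, w v z else 0) + w v u) * x u =
      ∑ v, ∑ u, w v u * (x v * (x v + x u)) := by
  refine Finset.sum_congr rfl fun v _ => ?_
  have h : ∑ u, x v * (if v = u then ∑ z, w v z else 0) * x u = ∑ u, w v u * (x v * x v) := by
    rw [← Finset.sum_mul]
    simp only [mul_ite, ite_mul, mul_zero, zero_mul, Finset.sum_ite_eq, Finset.mem_univ, if_true]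
    ring
  simp only [mul_add, add_mul, Finset.sum_add_distrib] at h ⊢
  rw [h]
  congr 1
  exact Finset.sum_congr rfl fun u _ => by ring

/-- The vector supported on `S` with signs given by the two-coloring `c`. -/
def signedIndicator {V : Type*} [DecidableEq V] (S : Finset V) (c : V → Bool) (v : V) : ℝ :=
  if v ∈ S then (if c v then 1 else -1) else 0

theorem sum_signedIndicator_sq {V : Type*} [Fintype V] [DecidableEq V] (S : Finset V)
    (c : V → Bool) : ∑ v, signedIndicator S c v ^ 2 = S.card := by
  have h : ∀ v, signedIndicator S c v ^ 2 = if v ∈ S then 1 else 0 := by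
    intro v
    unfold signedIndicator
    split_ifs <;> norm_num
  simp [h]

/-- The quadratic form at a signed indicator is bounded by the weight of the edges which
are cut or monochromatic. -/
theorem quadratic_form_signedIndicator_le {V : Type*} [Fintype V] [DecidableEq V]
    (w : V → V → ℝ) (hnn : ∀ v u, 0 ≤ w v u) (S : Finset V) (c : V → Bool) :
    ∑ v, ∑ u, w v u *
        (signedIndicator S c v * (signedIndicator S c v + signedIndicator S c u)) ≤
      4 * ((loopW w S + (1 / 2) *
        ∑ v ∈ S, ∑ u ∈ S, (if v ≠ u ∧ c v = c u then w v u else 0)) + cutW w S) := by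
  have hrow : ∀ v ∈ S, ∑ u, w v u *
      (signedIndicator S c v * (signedIndicator S c v + signedIndicator S c u)) ≤
      4 * w v v + 2 * ∑ u ∈ S, (if v ≠ u ∧ c v = c u then w v u else 0) +
        4 * ∑ u ∈ Sᶜ, w v u := by
    intro v hv
    have hloop : 4 * w v v = ∑ u ∈ S, if v = u then 4 * w v u else 0 := by
      simp [hv]
    rw [← Finset.sum_add_sum_compl S, hloop, Finset.mul_sum, Finset.mul_sum,
      ← Finset.sum_add_distrib]
    refine add_le_add (Finset.sum_le_sum fun u hu => ?_) (Finset.sum_le_sum fun u hu => ?_)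
    · have := hnn v u
      by_cases huv : v = u
      · subst huv
        cases hc : c v <;> simp [signedIndicator, hv, hc] <;> linarith
      · cases hc : c v <;> cases hd : c u <;>
          simp [signedIndicator, hv, hu, hc, hd, huv] <;> linarith
    · have := hnn v u
      rw [Finset.mem_compl] at hu
      cases hc : c v <;> simp [signedIndicator, hv, hu, hc] <;> linarith
  have hout : ∑ v ∈ Sᶜ, ∑ u, w v u *
      (signedIndicator S c v * (signedIndicator S c v + signedIndicator S c u)) = 0 :=
    Finset.sum_eq_zero fun v hv => Finset.sum_eq_zero fun u _ => by
      simp [signedIndicator, Finset.mem_compl.mp hv]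
  rw [← Finset.sum_add_sum_compl S, hout, add_zero]
  refine (Finset.sum_le_sum hrow).trans_eq ?_
  simp only [Finset.sum_add_distrib, ← Finset.mul_sum, loopW, cutW]
  ring

/-- Upper bound on the smallest eigenvalue of the signless Laplace matrix `Q = D + A` of a
weighted graph `(V, w)`: there is a nonzero real vector `x` with `xᵀ Q x ≤ 4Ψ · ‖x‖²`. -/
theorem signless_laplacian_min_eigenvalue_le {V : Type*} [Fintype V] [DecidableEq V]
    [Nonempty V] (w : V → V → ℝ) (hsymm : ∀ v u, w v u = w u v)
    (hnn : ∀ v u, 0 ≤ w v u) :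
    ∃ x : V → ℝ, x ≠ 0 ∧
      ∑ v, ∑ u, x v * ((if v = u then ∑ z, w v z else 0) + w v u) * x u ≤
        4 * PsiW w * ∑ v, (x v) ^ 2 := by
  have : Nonempty {S : Finset V // S.Nonempty} := ⟨⟨Finset.univ, Finset.univ_nonempty⟩⟩
  obtain ⟨⟨S, hS⟩, hPsi⟩ := exists_eq_ciInf_of_finite
    (f := fun S : {S : Finset V // S.Nonempty} => (eminW w S.1 + cutW w S.1) / (S.1.card : ℝ))
  obtain ⟨c, hc⟩ := exists_eq_ciInf_of_finite (f := fun c : V → Bool =>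
    loopW w S + (1 / 2) * ∑ v ∈ S, ∑ u ∈ S, (if v ≠ u ∧ c v = c u then w v u else 0))
  have hcard : (0 : ℝ) < S.card := by exact_mod_cast hS.card_pos
  refine ⟨signedIndicator S c, fun h => ?_, ?_⟩
  · have := sum_signedIndicator_sq S c
    simp only [h, Pi.zero_apply] at this
    norm_num at this
    exact hcard.ne this
  · rw [signless_laplacian_quadratic_form, sum_signedIndicator_sq]
    refine (quadratic_form_signedIndicator_le w hnn S c).trans_eq ?_
    have hemin : _ = eminW w S := hc
    have hPsi' : _ = PsiW w := hPsi
    rw [← hPsi', ← hemin]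
    field_simp
end

section
/- Let (V, w) be a weighted graph with V nonempty and w not identically zero (so d* > 0), and let Q = D + A be its signless Laplace matrix. Then every eigenvalue of Q is at least Ψ²/(4d*): for every real vector x indexed by V, xᵀ Q x ≥ (Ψ²/(4d*)) · ‖x‖². -/
/-- The maximal degree `d* = max_v Σ_u w(v,u)` of a weighted graph. -/
noncomputable def dstarW {V : Type*} [Fintype V] [Nonempty V] (w : V → V → ℝ) : ℝ :=
  ⨆ v, ∑ u, w v u

/-- The quadratic form of the signless Laplace matrix as a sum of weighted squares. -/
theorem signless_quadratic_form {V : Type*} [Fintype V] [DecidableEq V] (w : V → V → ℝ)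
    (hsymm : ∀ v u, w v u = w u v) (x : V → ℝ) :
    ∑ v, ∑ u, x v * ((if v = u then ∑ z, w v z else 0) + w v u) * x u =
      1 / 2 * ∑ v, ∑ u, w v u * (x v + x u) ^ 2 := by
  have h1 : ∑ v, ∑ u, w v u * x u ^ 2 = ∑ v, ∑ u, w v u * x v ^ 2 := by
    rw [Finset.sum_comm]
    exact Finset.sum_congr rfl fun v _ => Finset.sum_congr rfl fun u _ => by rw [hsymm]
  have h2 : ∑ v, ∑ u, x v * (if v = u then ∑ z, w v z else 0) * x u =
      ∑ v, ∑ u, w v u * x v ^ 2 := by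
    refine Finset.sum_congr rfl fun v _ => ?_
    simp only [mul_ite, ite_mul, mul_zero, zero_mul, Finset.sum_ite_eq, Finset.mem_univ, if_true,
      ← Finset.sum_mul]
    ring
  have h3 : ∑ v, ∑ u, w v u * (x v + x u) ^ 2 = ∑ v, ∑ u, w v u * x v ^ 2 +
      ∑ v, ∑ u, w v u * x u ^ 2 + 2 * ∑ v, ∑ u, x v * w v u * x u := by
    simp only [Finset.mul_sum, ← Finset.sum_add_distrib]
    exact Finset.sum_congr rfl fun v _ => Finset.sum_congr rfl fun u _ => by ring
  simp only [mul_add, add_mul, Finset.sum_add_distrib]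
  rw [h2, h3, h1]
  ring

/-- The piecewise linear functional of `y` whose value at the indicator function of `S` is the
weight of the loops and `c`-monochromatic edges in `S` plus the cut weight of `S`. -/
noncomputable def frustration {V : Type*} [Fintype V] [DecidableEq V] (w : V → V → ℝ)
    (c : V → Bool) (y : V → ℝ) : ℝ :=
  ∑ v, ∑ u, w v u * (1 / 2 * |y v - y u| +
    (if v = u then 1 else if c v = c u then 1 / 2 else 0) * min (y v) (y u))

theorem cutW_eq_sum_abs {V : Type*} [Fintype V] [DecidableEq V] (w : V → V → ℝ)
    (hsymm : ∀ v u, w v u = w u v) (S : Finset V) :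
    cutW w S = ∑ v, ∑ u, w v u *
      (1 / 2 * |(if v ∈ S then (1 : ℝ) else 0) - (if u ∈ S then 1 else 0)|) := by
  have h1 : cutW w S = ∑ v, ∑ u, if v ∈ S ∧ u ∉ S then w v u else 0 := by
    unfold cutW
    rw [← Finset.sum_filter_add_sum_filter_not Finset.univ (· ∈ S)
      (fun v => ∑ u, if v ∈ S ∧ u ∉ S then w v u else 0)]
    rw [Finset.sum_eq_zero (s := Finset.univ.filter (· ∉ S)), add_zero]
    · rw [Finset.filter_univ_mem]
      refine Finset.sum_congr rfl fun v hv => ?_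
      simp only [hv, true_and]
      rw [← Finset.sum_filter]
      exact Finset.sum_congr (by ext; simp) fun _ _ => rfl
    · intro v hv
      simp only [Finset.mem_filter] at hv
      simp [hv.2]
  have h2 : cutW w S = ∑ v, ∑ u, if u ∈ S ∧ v ∉ S then w v u else 0 := by
    rw [h1, Finset.sum_comm]
    exact Finset.sum_congr rfl fun v _ => Finset.sum_congr rfl fun u _ => by rw [hsymm]
  have h3 : cutW w S = 1 / 2 * (cutW w S + cutW w S) := by ring
  rw [h3]
  nth_rewrite 1 [h1]
  rw [h2]
  simp only [Finset.mul_sum, ← Finset.sum_add_distrib]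
  refine Finset.sum_congr rfl fun v _ => Finset.sum_congr rfl fun u _ => ?_
  by_cases hv : v ∈ S <;> by_cases hu : u ∈ S <;> simp [hv, hu] <;> ring

theorem frustration_indicator {V : Type*} [Fintype V] [DecidableEq V] (w : V → V → ℝ)
    (hsymm : ∀ v u, w v u = w u v) (c : V → Bool) (S : Finset V) :
    frustration w c (fun v => if v ∈ S then 1 else 0) =
      (loopW w S + (1 / 2) * ∑ v ∈ S, ∑ u ∈ S, (if v ≠ u ∧ c v = c u then w v u else 0)) +
        cutW w S := by
  have h1 : loopW w S = ∑ v, ∑ u, if v = u ∧ v ∈ S then w v u else 0 := by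
    simp [loopW, ite_and]
  have h2 : ∑ v ∈ S, ∑ u ∈ S, (if v ≠ u ∧ c v = c u then w v u else 0) =
      ∑ v, ∑ u, if v ∈ S ∧ u ∈ S ∧ v ≠ u ∧ c v = c u then w v u else 0 := by
    simp_rw [ite_and]
    simp [Finset.sum_ite_mem]
  rw [h1, h2, cutW_eq_sum_abs w hsymm S, frustration]
  simp only [Finset.mul_sum, ← Finset.sum_add_distrib]
  refine Finset.sum_congr rfl fun v _ => Finset.sum_congr rfl fun u _ => ?_
  by_cases hvu : v = u
  · subst hvu
    by_cases hv : v ∈ S <;> simp [hv]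
  · by_cases hc : c v = c u <;> by_cases hv : v ∈ S <;> by_cases hu : u ∈ S <;>
      simp [hv, hu, hvu, hc] <;> ring

theorem eminW_le {V : Type*} [Fintype V] [DecidableEq V] (w : V → V → ℝ) (c : V → Bool)
    (S : Finset V) :
    eminW w S ≤
      loopW w S + (1 / 2) * ∑ v ∈ S, ∑ u ∈ S, (if v ≠ u ∧ c v = c u then w v u else 0) :=
  ciInf_le (Set.finite_range _).bddBelow c

theorem PsiW_mul_card_le {V : Type*} [Fintype V] [DecidableEq V] [Nonempty V] (w : V → V → ℝ)
    (S : Finset V) (hS : S.Nonempty) : PsiW w * S.card ≤ eminW w S + cutW w S := by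
  have h : PsiW w ≤ (eminW w S + cutW w S) / (S.card : ℝ) :=
    ciInf_le (f := fun S : {S : Finset V // S.Nonempty} =>
      (eminW w S.1 + cutW w S.1) / (S.1.card : ℝ)) (Set.finite_range _).bddBelow ⟨S, hS⟩
  have hpos : (0 : ℝ) < S.card := by exact_mod_cast hS.card_pos
  exact (le_div_iff₀ hpos).1 h

theorem PsiW_nonneg {V : Type*} [Fintype V] [DecidableEq V] [Nonempty V] (w : V → V → ℝ)
    (hnn : ∀ v u, 0 ≤ w v u) : 0 ≤ PsiW w := by
  refine Real.iInf_nonneg fun S => div_nonneg (add_nonneg ?_ ?_) (Nat.cast_nonneg _)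
  · refine Real.iInf_nonneg fun c => add_nonneg (Finset.sum_nonneg fun v _ => hnn v v)
      (mul_nonneg (by norm_num) (Finset.sum_nonneg fun v _ => Finset.sum_nonneg fun u _ => ?_))
    split_ifs
    exacts [hnn v u, le_rfl]
  · exact Finset.sum_nonneg fun v _ => Finset.sum_nonneg fun u _ => hnn v u

theorem frustration_eq_add {V : Type*} [Fintype V] [DecidableEq V] (w : V → V → ℝ)
    (c : V → Bool) (y : V → ℝ) (S : Finset V) (m : ℝ) (hm : 0 ≤ m)
    (hS : ∀ v ∈ S, m ≤ y v) (hS' : ∀ v ∉ S, y v = 0) :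
    frustration w c y = frustration w c (fun v => y v - m * if v ∈ S then 1 else 0) +
      m * frustration w c (fun v => if v ∈ S then 1 else 0) := by
  simp only [frustration, Finset.mul_sum, ← Finset.sum_add_distrib]
  refine Finset.sum_congr rfl fun v _ => Finset.sum_congr rfl fun u _ => ?_
  by_cases hv : v ∈ S <;> by_cases hu : u ∈ S
  · simp only [hv, hu, if_true, mul_one, min_sub_sub_right, sub_sub_sub_cancel_right, sub_self,
      abs_zero, min_self]
    ring
  · have h1 := hS v hv
    simp only [hv, hu, if_true, if_false, hS' u hu, mul_one, mul_zero, sub_zero]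
    rw [abs_of_nonneg (hm.trans h1), abs_of_nonneg (sub_nonneg.2 h1),
      min_eq_right (hm.trans h1), min_eq_right (sub_nonneg.2 h1)]
    simp
    ring
  · have h1 := hS u hu
    simp only [hv, hu, if_true, if_false, hS' v hv, mul_one, mul_zero, sub_zero, zero_sub, abs_neg]
    rw [abs_of_nonneg (hm.trans h1), abs_of_nonneg (sub_nonneg.2 h1),
      min_eq_left (hm.trans h1), min_eq_left (sub_nonneg.2 h1)]
    simp
    ring
  · simp [hv, hu, hS' v hv, hS' u hu]

theorem PsiW_mul_sum_le_frustration {V : Type*} [Fintype V] [DecidableEq V] [Nonempty V]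
    (w : V → V → ℝ) (hsymm : ∀ v u, w v u = w u v) (c : V → Bool) (y : V → ℝ)
    (hy : ∀ v, 0 ≤ y v) : PsiW w * ∑ v, y v ≤ frustration w c y := by
  induction hn : (Finset.univ.filter (fun v => y v ≠ 0)).card using Nat.strong_induction_on
    generalizing y with
  | _ n ih =>
    set S := Finset.univ.filter (fun v => y v ≠ 0) with hSdef
    have hmem : ∀ v, v ∈ S ↔ y v ≠ 0 := fun v => by simp [hSdef]
    rcases S.eq_empty_or_nonempty with hS | hS
    · have h0 : ∀ v, y v = 0 := fun v => by
        by_contra h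
        simpa [hS] using (hmem v).2 h
      simp [frustration, h0]
    · obtain ⟨a, ha, hmin⟩ := S.exists_min_image y hS
      have hout : ∀ v ∉ S, y v = 0 := fun v hv => by
        by_contra h
        exact hv ((hmem v).2 h)
      rw [frustration_eq_add w c y S (y a) (hy a) hmin hout]
      set y' : V → ℝ := fun v => y v - y a * if v ∈ S then 1 else 0 with hy'
      have hy'0 : ∀ v, 0 ≤ y' v := fun v => by
        by_cases hv : v ∈ S
        · simpa [hy', hv] using hmin v hv
        · simp [hy', hv, hout v hv]
      have hlt : (Finset.univ.filter (fun v => y' v ≠ 0)).card < n := by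
        rw [← hn]
        refine Finset.card_lt_card (Finset.ssubset_iff_of_subset ?_ |>.2 ⟨a, ha, by simp [hy', ha]⟩)
        intro v hv
        by_contra h
        simp [hy', h, hout v h] at hv
      have h1 := ih _ hlt y' hy'0 rfl
      have h2 : ∑ v, y v = ∑ v, y' v + y a * S.card := by
        simp [hy', Finset.sum_sub_distrib, mul_comm]
      have h3 : PsiW w * S.card ≤ frustration w c (fun v => if v ∈ S then 1 else 0) := by
        rw [frustration_indicator w hsymm]
        linarith [PsiW_mul_card_le w S hS, eminW_le w c S]
      have h4 := mul_le_mul_of_nonneg_left h3 (hy a)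
      rw [h2]
      linarith

theorem frustration_sq_le {V : Type*} [Fintype V] [DecidableEq V] (w : V → V → ℝ)
    (hnn : ∀ v u, 0 ≤ w v u) (x : V → ℝ) :
    frustration w (fun v => decide (0 ≤ x v)) (fun v => x v ^ 2) ≤
      ∑ v, ∑ u, w v u * (1 / 2 * (|x v + x u| * (|x v| + |x u|))) := by
  refine Finset.sum_le_sum fun v _ => Finset.sum_le_sum fun u _ =>
    mul_le_mul_of_nonneg_left ?_ (hnn v u)
  have hsame : |x v + x u| = |x v| + |x u| → 1 / 2 * |x v ^ 2 - x u ^ 2| +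
      1 / 2 * min (x v ^ 2) (x u ^ 2) ≤ 1 / 2 * (|x v + x u| * (|x v| + |x u|)) := by
    intro h
    rw [h, ← sq_abs (x v), ← sq_abs (x u)]
    have hv := abs_nonneg (x v)
    have hu := abs_nonneg (x u)
    rcases le_total (|x v| ^ 2) (|x u| ^ 2) with h' | h'
    · rw [min_eq_left h', abs_of_nonpos (by linarith)]
      nlinarith [mul_nonneg hv hu]
    · rw [min_eq_right h', abs_of_nonneg (by linarith)]
      nlinarith [mul_nonneg hv hu]
  by_cases hvu : v = u
  · subst hvu
    simp only [sub_self, abs_zero, min_self, if_true]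
    rw [← two_mul, ← two_mul, abs_mul, abs_two]
    nlinarith [sq_abs (x v), sq_nonneg (x v)]
  · by_cases hc : decide (0 ≤ x v) = decide (0 ≤ x u)
    · simp only [hvu, if_false, hc, if_true]
      refine hsame ?_
      rw [decide_eq_decide] at hc
      by_cases hv : 0 ≤ x v
      · exact (abs_add_eq_add_abs_iff _ _).2 (Or.inl ⟨hv, hc.1 hv⟩)
      · exact (abs_add_eq_add_abs_iff _ _).2
          (Or.inr ⟨(not_le.1 hv).le, (not_le.1 fun h => hv (hc.2 h)).le⟩)
    · simp only [hvu, if_false, hc, zero_mul, add_zero]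
      rw [sq_sub_sq, abs_mul]
      have := abs_sub (x v) (x u)
      gcongr

theorem sum_mul_abs_add_sq_le {V : Type*} [Fintype V] [Nonempty V] (w : V → V → ℝ)
    (hsymm : ∀ v u, w v u = w u v) (hnn : ∀ v u, 0 ≤ w v u) (x : V → ℝ) :
    ∑ v, ∑ u, w v u * (|x v| + |x u|) ^ 2 ≤ 4 * dstarW w * ∑ v, x v ^ 2 := by
  have h1 : ∑ v, ∑ u, w v u * x u ^ 2 = ∑ v, ∑ u, w v u * x v ^ 2 := by
    rw [Finset.sum_comm]
    exact Finset.sum_congr rfl fun v _ => Finset.sum_congr rfl fun u _ => by rw [hsymm]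
  have h2 : ∑ v, ∑ u, w v u * x v ^ 2 ≤ dstarW w * ∑ v, x v ^ 2 := by
    rw [Finset.mul_sum]
    refine Finset.sum_le_sum fun v _ => ?_
    rw [← Finset.sum_mul]
    exact mul_le_mul_of_nonneg_right
      (le_ciSup (f := fun v => ∑ u, w v u) (Set.finite_range _).bddAbove v) (sq_nonneg _)
  have h3 : ∑ v, ∑ u, w v u * (|x v| + |x u|) ^ 2 ≤
      2 * ∑ v, ∑ u, w v u * x v ^ 2 + 2 * ∑ v, ∑ u, w v u * x u ^ 2 := by
    simp only [Finset.mul_sum, ← Finset.sum_add_distrib]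
    refine Finset.sum_le_sum fun v _ => Finset.sum_le_sum fun u _ => ?_
    have := mul_le_mul_of_nonneg_left (add_sq_le (a := |x v|) (b := |x u|)) (hnn v u)
    rw [sq_abs, sq_abs] at this
    linarith
  linarith

/-- Lower bound on the eigenvalues of the signless Laplace matrix `Q = D + A` of a weighted
graph `(V, w)` with `w` not identically zero: every eigenvalue is at least `Ψ²/(4d*)`, i.e.
`xᵀ Q x ≥ (Ψ²/(4d*)) · ‖x‖²` for every real vector `x`. -/
theorem signless_laplacian_eigenvalue_lower_bound {V : Type*} [Fintype V] [DecidableEq V]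
    [Nonempty V] (w : V → V → ℝ) (hsymm : ∀ v u, w v u = w u v)
    (hnn : ∀ v u, 0 ≤ w v u) (hw : w ≠ 0) :
    ∀ x : V → ℝ,
      (PsiW w) ^ 2 / (4 * dstarW w) * ∑ v, (x v) ^ 2 ≤
        ∑ v, ∑ u, x v * ((if v = u then ∑ z, w v z else 0) + w v u) * x u := by
  intro x
  rw [signless_quadratic_form w hsymm]
  set N := ∑ v, x v ^ 2 with hN
  set E := ∑ v, ∑ u, w v u * (x v + x u) ^ 2 with hE
  set H := ∑ v, ∑ u, w v u * (|x v| + |x u|) ^ 2 with hH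
  have hE0 : 0 ≤ E := Finset.sum_nonneg fun v _ => Finset.sum_nonneg fun u _ =>
    mul_nonneg (hnn v u) (sq_nonneg _)
  have hN0 : 0 ≤ N := Finset.sum_nonneg fun v _ => sq_nonneg _
  have hHN : H ≤ 4 * dstarW w * N := sum_mul_abs_add_sq_le w hsymm hnn x
  have hd : 0 < dstarW w := by
    obtain ⟨v, hv⟩ := Function.ne_iff.1 hw
    obtain ⟨u, hu⟩ := Function.ne_iff.1 hv
    calc 0 < w v u := lt_of_le_of_ne (hnn v u) (Ne.symm hu)
      _ ≤ ∑ z, w v z := Finset.single_le_sum (fun z _ => hnn v z) (Finset.mem_univ u)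
      _ ≤ dstarW w := le_ciSup (f := fun v => ∑ u, w v u) (Set.finite_range _).bddAbove v
  set R := ∑ v, ∑ u, w v u * (|x v + x u| * (|x v| + |x u|)) with hR
  have hRle : PsiW w * N ≤ 1 / 2 * R := by
    have h := (PsiW_mul_sum_le_frustration w hsymm (fun v => decide (0 ≤ x v)) (fun v => x v ^ 2)
      fun v => sq_nonneg _).trans (frustration_sq_le w hnn x)
    refine h.trans_eq ?_
    simp only [hR, Finset.mul_sum]
    exact Finset.sum_congr rfl fun v _ => Finset.sum_congr rfl fun u _ => by ring
  have hCS : R ^ 2 ≤ E * H := by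
    rw [hR, hE, hH, ← Finset.sum_product', ← Finset.sum_product', ← Finset.sum_product']
    refine Finset.sum_sq_le_sum_mul_sum_of_sq_le_mul _
      (fun p _ => mul_nonneg (hnn _ _) (sq_nonneg _))
      (fun p _ => mul_nonneg (hnn _ _) (sq_nonneg _)) fun p _ => le_of_eq ?_
    rw [← sq_abs (x p.1 + x p.2)]
    ring
  have hΨN : 0 ≤ PsiW w * N := mul_nonneg (PsiW_nonneg w hnn) hN0
  rcases hN0.eq_or_lt with h0 | hpos
  · rw [← h0]
    linarith
  · have h1 : (PsiW w * N) ^ 2 ≤ (1 / 2 * R) ^ 2 := pow_le_pow_left₀ hΨN hRle 2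
    have h2 : E * H ≤ E * (4 * dstarW w * N) := mul_le_mul_of_nonneg_left hHN hE0
    have h3 : N * (PsiW w ^ 2 * N) ≤ N * (dstarW w * E) := by nlinarith
    have h4 := le_of_mul_le_mul_left h3 hpos
    rw [div_mul_eq_mul_div, div_le_iff₀ (by positivity)]
    nlinarith [mul_nonneg hd.le hE0]
end
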